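/- Let m : ℕ → ℕ and set ζ(n) := (2·m(n) − 2n)·n^{−3/5}. Suppose ζ(n) → −∞ and |ζ(n)|/n^{2/5} → 0 as n → ∞. If l₀ : ℕ → ℝ is such that for every sufficiently large n, l₀(n) solves the excess equation for (n, m(n)), then there exist constants c₁, c₂ > 0 such that for all sufficiently large n: c₁·|ζ(n)|^{−2/3}·n^{3/5} ≤ l₀(n) ≤ c₂·|ζ(n)|^{−2/3}·n^{3/5}. -/

import Mathlib

open Filter

/-- The constant γ = 79^(3/4)/54^(1/2). -/
noncomputable def gammaK : ℝ := (79 : ℝ) ^ ((3 : ℝ) / 4) / (54 : ℝ) ^ ((1 : ℝ) / 2)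

/-- The constant φ = 2·√e·γ²·3^(−3/2). -/
noncomputable def phiC : ℝ := 2 * Real.sqrt (Real.exp 1) * gammaK ^ 2 * (3 : ℝ) ^ (-(3 : ℝ) / 2)

/-- `l₀` solves the excess equation for `(n, m)`: it lies strictly between
`max 0 (m − n)` and `m − n/2` and satisfies
`l₀ · e^(1/3) · 2^(4/3) · (n − m + l₀)^(2/3) = φ^(2/3) · (2m − n − 2l₀)`. -/
def SolvesExcessEq (n m l₀ : ℝ) : Prop :=
  max 0 (m - n) < l₀ ∧ l₀ < m - n / 2 ∧
    l₀ * Real.exp 1 ^ ((1 : ℝ) / 3) * (2 : ℝ) ^ ((4 : ℝ) / 3) * (n - m + l₀) ^ ((2 : ℝ) / 3)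
      = phiC ^ ((2 : ℝ) / 3) * (2 * m - n - 2 * l₀)

theorem core_bound (A B : ℝ) (hA : 0 < A) (hB : 0 < B) (k k2 c2 : ℝ) (hk : 0 < k)
    (hk2 : 0 < k2) (hc2 : c2 = B / (A * k)) (hkdef : k = (1 / 2 : ℝ) ^ ((2 : ℝ) / 3))
    (hk2def : k2 = (1 / 2 + c2) ^ ((2 : ℝ) / 3))
    (n D l w : ℝ) (hn : 0 < n) (hD : 0 < D) (hl : 0 < l)
    (hw : w * D ^ ((2 : ℝ) / 3) = n) (hwD : w ≤ D) (hDn : D * (2 * (1 + 2 * c2)) ≤ n)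
    (heq : A * l * (D / 2 + l) ^ ((2 : ℝ) / 3) = B * (n - D - 2 * l)) :
    B / (2 * A * k2) * w ≤ l ∧ l ≤ c2 * w := by
  have hP : 0 < D ^ ((2 : ℝ) / 3) := Real.rpow_pos_of_pos hD _
  have hc2p : 0 < c2 := by rw [hc2]; positivity
  have hQ1 : k * D ^ ((2 : ℝ) / 3) ≤ (D / 2 + l) ^ ((2 : ℝ) / 3) := by
    rw [hkdef, ← Real.mul_rpow (by norm_num) hD.le]
    apply Real.rpow_le_rpow (by positivity) (by linarith) (by norm_num)
  have hup : l ≤ c2 * w := by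
    have h1 : A * l * (k * D ^ ((2 : ℝ) / 3)) ≤ B * w * D ^ ((2 : ℝ) / 3) := by
      calc _ ≤ A * l * (D / 2 + l) ^ ((2 : ℝ) / 3) := by gcongr
        _ = B * (n - D - 2 * l) := heq
        _ ≤ B * n := by gcongr; linarith
        _ = _ := by rw [← hw]; ring
    have h2 : A * l * k ≤ B * w := by
      apply le_of_mul_le_mul_right _ hP
      linarith
    rw [hc2, div_mul_eq_mul_div, le_div_iff₀ (by positivity)]
    linarith
  refine ⟨?_, hup⟩
  have hlD : l ≤ c2 * D := hup.trans (by gcongr)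
  have hQ2 : (D / 2 + l) ^ ((2 : ℝ) / 3) ≤ k2 * D ^ ((2 : ℝ) / 3) := by
    rw [hk2def, ← Real.mul_rpow (by positivity) hD.le]
    apply Real.rpow_le_rpow (by positivity) (by linarith) (by norm_num)
  have h1 : B * (w / 2) * D ^ ((2 : ℝ) / 3) ≤ A * l * k2 * D ^ ((2 : ℝ) / 3) := by
    calc _ = B * (n / 2) := by rw [← hw]; ring
      _ ≤ B * (n - D - 2 * l) := by gcongr; linarith
      _ = A * l * (D / 2 + l) ^ ((2 : ℝ) / 3) := heq.symm
      _ ≤ A * l * (k2 * D ^ ((2 : ℝ) / 3)) := by gcongr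
      _ = _ := by ring
  have h2 := le_of_mul_le_mul_right h1 hP
  rw [div_mul_eq_mul_div, div_le_iff₀ (by positivity)]
  linarith

theorem stmt7 (m : ℕ → ℕ) (l₀ : ℕ → ℝ)
    (hzeta : Tendsto (fun n : ℕ => ((2 * m n : ℝ) - 2 * n) * (n : ℝ) ^ (-(3 : ℝ) / 5)) atTop atBot)
    (hzeta' : Tendsto
      (fun n : ℕ => |((2 * m n : ℝ) - 2 * n) * (n : ℝ) ^ (-(3 : ℝ) / 5)| / (n : ℝ) ^ ((2 : ℝ) / 5))
      atTop (nhds 0))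
    (hl : ∀ᶠ n : ℕ in atTop, SolvesExcessEq n (m n) (l₀ n)) :
    ∃ c₁ c₂ : ℝ, 0 < c₁ ∧ 0 < c₂ ∧ ∀ᶠ n : ℕ in atTop,
      c₁ * |((2 * m n : ℝ) - 2 * n) * (n : ℝ) ^ (-(3 : ℝ) / 5)| ^ (-(2 : ℝ) / 3)
          * (n : ℝ) ^ ((3 : ℝ) / 5) ≤ l₀ n ∧
      l₀ n ≤ c₂ * |((2 * m n : ℝ) - 2 * n) * (n : ℝ) ^ (-(3 : ℝ) / 5)| ^ (-(2 : ℝ) / 3)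
          * (n : ℝ) ^ ((3 : ℝ) / 5) := by
  have hphi : 0 < phiC := by
    unfold phiC gammaK
    positivity
  obtain ⟨A, hAdef⟩ : ∃ A : ℝ, A = Real.exp 1 ^ ((1 : ℝ) / 3) * (2 : ℝ) ^ ((4 : ℝ) / 3) := ⟨_, rfl⟩
  obtain ⟨B, hBdef⟩ : ∃ B : ℝ, B = phiC ^ ((2 : ℝ) / 3) := ⟨_, rfl⟩
  obtain ⟨k, hk⟩ : ∃ k : ℝ, k = (1 / 2 : ℝ) ^ ((2 : ℝ) / 3) := ⟨_, rfl⟩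
  obtain ⟨c2, hc2⟩ : ∃ c2 : ℝ, c2 = B / (A * k) := ⟨_, rfl⟩
  obtain ⟨k2, hk2⟩ : ∃ k2 : ℝ, k2 = (1 / 2 + c2) ^ ((2 : ℝ) / 3) := ⟨_, rfl⟩
  have hA : 0 < A := by rw [hAdef]; positivity
  have hB : 0 < B := by rw [hBdef]; positivity
  have hkp : 0 < k := by rw [hk]; positivity
  have hc2p : 0 < c2 := by rw [hc2]; positivity
  have hk2p : 0 < k2 := by rw [hk2]; positivity
  refine ⟨B / (2 * A * k2), c2, by positivity, hc2p, ?_⟩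
  have hε : (0 : ℝ) < 1 / (2 * (1 + 2 * c2)) := by positivity
  filter_upwards [hl, hzeta.eventually_le_atBot (-1), hzeta'.eventually_lt_const hε,
    eventually_gt_atTop 0] with n hs hz hz' hn0
  obtain ⟨h1, h2, h3⟩ := hs
  have hn : (0 : ℝ) < n := by exact_mod_cast hn0
  have hlp : 0 < l₀ n := (le_max_left _ _).trans_lt h1
  have hr : 0 < (n : ℝ) ^ (-(3 : ℝ) / 5) := Real.rpow_pos_of_pos hn _
  obtain ⟨D, hD⟩ : ∃ D : ℝ, D = 2 * n - 2 * m n := ⟨_, rfl⟩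
  have hDz : ((2 * m n : ℝ) - 2 * n) = -D := by rw [hD]; ring
  rw [hDz] at hz hz' ⊢
  have hDr : 1 ≤ D * (n : ℝ) ^ (-(3 : ℝ) / 5) := by linarith
  have hDp : 0 < D := by
    by_contra h
    have := mul_nonpos_of_nonpos_of_nonneg (not_lt.mp h) hr.le
    linarith
  have habs : |-D * (n : ℝ) ^ (-(3 : ℝ) / 5)| = D * (n : ℝ) ^ (-(3 : ℝ) / 5) := by
    rw [neg_mul, abs_neg, abs_of_pos (by positivity)]
  rw [habs] at hz' ⊢
  rw [mul_assoc, mul_assoc c2]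
  have hPp : 0 < D ^ ((2 : ℝ) / 3) := Real.rpow_pos_of_pos hDp _
  have hw : (D * (n : ℝ) ^ (-(3 : ℝ) / 5)) ^ (-(2 : ℝ) / 3) * (n : ℝ) ^ ((3 : ℝ) / 5)
      * D ^ ((2 : ℝ) / 3) = n := by
    rw [Real.mul_rpow hDp.le hr.le, ← Real.rpow_mul hn.le]
    have e1 : D ^ (-(2 : ℝ) / 3) * D ^ ((2 : ℝ) / 3) = 1 := by
      rw [← Real.rpow_add hDp]; norm_num
    have e2 : (n : ℝ) ^ (-(3 : ℝ) / 5 * (-(2 : ℝ) / 3)) * (n : ℝ) ^ ((3 : ℝ) / 5) = n := by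
      rw [← Real.rpow_add hn]; norm_num
    calc _ = (D ^ (-(2 : ℝ) / 3) * D ^ ((2 : ℝ) / 3)) *
        ((n : ℝ) ^ (-(3 : ℝ) / 5 * (-(2 : ℝ) / 3)) * (n : ℝ) ^ ((3 : ℝ) / 5)) := by ring
      _ = n := by rw [e1, e2, one_mul]
  have e3 : (n : ℝ) ^ (-(3 : ℝ) / 5) * (n : ℝ) ^ ((3 : ℝ) / 5) = 1 := by
    rw [← Real.rpow_add hn]; norm_num
  have hr2 : 0 < (n : ℝ) ^ ((3 : ℝ) / 5) := Real.rpow_pos_of_pos hn _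
  refine core_bound A B hA hB k k2 c2 hkp hk2p hc2 hk hk2 n D (l₀ n) _ hn hDp hlp hw ?_ ?_ ?_
  · have e4 : (D * (n : ℝ) ^ (-(3 : ℝ) / 5)) ^ (-(2 : ℝ) / 3) ≤ 1 :=
      Real.rpow_le_one_of_one_le_of_nonpos hDr (by norm_num)
    calc _ ≤ 1 * (n : ℝ) ^ ((3 : ℝ) / 5) := by gcongr
      _ ≤ (D * (n : ℝ) ^ (-(3 : ℝ) / 5)) * (n : ℝ) ^ ((3 : ℝ) / 5) := by gcongr
      _ = D := by rw [mul_assoc, e3, mul_one]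
  · have e5 : (n : ℝ) ^ ((2 : ℝ) / 5) * (n : ℝ) ^ ((3 : ℝ) / 5) = n := by
      rw [← Real.rpow_add hn]; norm_num
    have hr3 : 0 < (n : ℝ) ^ ((2 : ℝ) / 5) := Real.rpow_pos_of_pos hn _
    rw [div_lt_div_iff₀ hr3 (by positivity), one_mul] at hz'
    calc D * (2 * (1 + 2 * c2))
        = (D * (n : ℝ) ^ (-(3 : ℝ) / 5) * (2 * (1 + 2 * c2))) * (n : ℝ) ^ ((3 : ℝ) / 5) := by
          linear_combination (-(D * (2 * (1 + 2 * c2)))) * e3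
      _ ≤ (n : ℝ) ^ ((2 : ℝ) / 5) * (n : ℝ) ^ ((3 : ℝ) / 5) := by gcongr
      _ = n := e5
  · have hd : D / 2 + l₀ n = n - m n + l₀ n := by rw [hD]; ring
    rw [hd, hAdef, hBdef]
    rw [show (n : ℝ) - D - 2 * l₀ n = 2 * m n - n - 2 * l₀ n by rw [hD]; ring, ← h3]
    ring
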